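/- arXiv:2105.06890 — 3 statements merged into one kernel-verified Lean document; each statement's English description precedes it below -/
import Mathlib

section
/- For every integer k ≥ 2, every taper h, and every T > 0, the Fejér-type tapered kernel integrates to one: ∫_{ℝ^{k−1}} F^h_{k,T}(u) du = 1. -/
open MeasureTheory Filter Topology
open scoped ENNReal NNReal

noncomputable section

/-- A taper: continuous, nonnegative, of bounded variation, supported in `[0,1]`,
with `H_k = ∫_0^1 h^k > 0` for all `k ≥ 1`. -/
def IsTaper (h : ℝ → ℝ) : Prop :=
  Continuous h ∧ (∀ t, 0 ≤ h t) ∧ BoundedVariationOn h Set.univ ∧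
    Function.support h ⊆ Set.Icc 0 1 ∧
    ∀ k : ℕ, 1 ≤ k → 0 < ∫ t in (0:ℝ)..1, h t ^ k

/-- `H_k := ∫_0^1 h(t)^k dt`. -/
def Hcoef (h : ℝ → ℝ) (k : ℕ) : ℝ := ∫ t in (0:ℝ)..1, h t ^ k

/-- `H_{1,T}(λ) := ∫_0^T h(t/T) e^{-iλt} dt`. -/
def H1T (h : ℝ → ℝ) (T l : ℝ) : ℂ :=
  ∫ t in (0:ℝ)..T, (h (t / T) : ℂ) * Complex.exp (-Complex.I * (l : ℂ) * (t : ℂ))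

/-- The Fejér-type tapered kernel
`F^h_{k,T}(u) = H_{1,T}(u₁)⋯H_{1,T}(u_{k-1})·H_{1,T}(-(u₁+⋯+u_{k-1})) / ((2π)^{k-1} T H_k)`
(a real-valued quantity). -/
def fejerKer (h : ℝ → ℝ) (k : ℕ) (T : ℝ) (u : Fin (k - 1) → ℝ) : ℝ :=
  (((∏ i, H1T h T (u i)) * H1T h T (-(∑ i, u i))) /
    ((((2 * Real.pi) ^ (k - 1) * (T * Hcoef h k) : ℝ)) : ℂ)).re

open scoped FourierTransform Convolution

lemma rpow_neg_one_mul_rpow_neg_le {r : ℝ} (hr : 0 < r) (hr1 : r ≤ 1) {a b c : ℝ} (ha : 1 ≤ a)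
    (hb : 1 ≤ b) (hc : 1 ≤ c) (hcab : c ≤ a * b) :
    a ^ (-1 : ℝ) * b ^ (-r) ≤
      c ^ (-(r / 3)) * (a ^ (-(1 + r / 3)) + b ^ (-(1 + r / 3))) := by
  have ha0 : 0 < a := by linarith
  have hb0 : 0 < b := by linarith
  have hc0 : 0 < c := by linarith
  have h1 : a ^ (-(r / 3)) * b ^ (-(r / 3)) ≤ c ^ (-(r / 3)) := by
    rw [← Real.mul_rpow ha0.le hb0.le]
    exact Real.rpow_le_rpow_of_nonpos hc0 hcab (by linarith)
  have h2 : a ^ (-(1 - r / 3)) * b ^ (-(2 * r / 3)) ≤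
      a ^ (-(1 + r / 3)) + b ^ (-(1 + r / 3)) := by
    rcases le_total a b with hab | hab
    · calc a ^ (-(1 - r / 3)) * b ^ (-(2 * r / 3))
          ≤ a ^ (-(1 - r / 3)) * a ^ (-(2 * r / 3)) := by
            gcongr ?_ * ?_
            exact Real.rpow_le_rpow_of_nonpos ha0 hab (by linarith)
        _ = a ^ (-(1 + r / 3)) := by rw [← Real.rpow_add ha0]; ring_nf
        _ ≤ _ := le_add_of_nonneg_right (by positivity)
    · calc a ^ (-(1 - r / 3)) * b ^ (-(2 * r / 3))
          ≤ b ^ (-(1 - r / 3)) * b ^ (-(2 * r / 3)) := by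
            gcongr ?_ * ?_
            exact Real.rpow_le_rpow_of_nonpos hb0 hab (by linarith)
        _ = b ^ (-(1 + r / 3)) := by rw [← Real.rpow_add hb0]; ring_nf
        _ ≤ _ := le_add_of_nonneg_left (by positivity)
  calc a ^ (-1 : ℝ) * b ^ (-r)
      = (a ^ (-(r / 3)) * b ^ (-(r / 3))) * (a ^ (-(1 - r / 3)) * b ^ (-(2 * r / 3))) := by
        rw [mul_mul_mul_comm, ← Real.rpow_add ha0, ← Real.rpow_add hb0]
        ring_nf
    _ ≤ _ := by gcongr

/-- Convolving `(1 + ‖u‖)⁻¹` with `(1 + ‖u‖)^(-r)` leaves a decay of order `r / 3`. -/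
lemma exists_integral_rpow_conv_le {r : ℝ} (hr : 0 < r) (hr1 : r ≤ 1) :
    ∃ C : ℝ, ∀ v : ℝ,
      Integrable (fun u : ℝ ↦ (1 + ‖u‖) ^ (-1 : ℝ) * (1 + ‖v - u‖) ^ (-r)) ∧
      ∫ u : ℝ, (1 + ‖u‖) ^ (-1 : ℝ) * (1 + ‖v - u‖) ^ (-r) ≤
        C * (1 + ‖v‖) ^ (-(r / 3)) := by
  have hI : Integrable (fun u : ℝ ↦ (1 + ‖u‖) ^ (-(1 + r / 3))) :=
    integrable_one_add_norm (by simp; positivity)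
  refine ⟨2 * ∫ u : ℝ, (1 + ‖u‖) ^ (-(1 + r / 3)), fun v ↦ ?_⟩
  have hJ := hI.comp_sub_left v
  have hle : ∀ u : ℝ, (1 + ‖u‖) ^ (-1 : ℝ) * (1 + ‖v - u‖) ^ (-r) ≤
      (1 + ‖v‖) ^ (-(r / 3)) *
        ((1 + ‖u‖) ^ (-(1 + r / 3)) + (1 + ‖v - u‖) ^ (-(1 + r / 3))) := fun u ↦ by
    refine rpow_neg_one_mul_rpow_neg_le hr hr1 (by simp) (by simp) (by simp) ?_
    have : ‖v‖ ≤ ‖u‖ + ‖v - u‖ := by simpa using norm_add_le u (v - u)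
    nlinarith [norm_nonneg u, norm_nonneg (v - u), mul_nonneg (norm_nonneg u) (norm_nonneg (v - u))]
  have hK := (hI.add hJ).const_mul ((1 + ‖v‖) ^ (-(r / 3)))
  have hint : Integrable (fun u : ℝ ↦ (1 + ‖u‖) ^ (-1 : ℝ) * (1 + ‖v - u‖) ^ (-r)) := by
    refine hK.mono' (Measurable.aestronglyMeasurable (by fun_prop)) (ae_of_all _ fun u ↦ ?_)
    rw [Real.norm_of_nonneg (by positivity)]
    exact hle u
  refine ⟨hint, (integral_mono hint hK hle).trans (le_of_eq ?_)⟩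
  simp only [Pi.add_apply]
  rw [integral_const_mul, integral_add hI hJ,
    integral_sub_left_eq_self (fun u : ℝ ↦ (1 + ‖u‖) ^ (-(1 + r / 3))) volume v]
  ring

lemma integrable_prod_rpow_neg (n : ℕ) : ∀ {r : ℝ}, 0 < r → r ≤ 1 → ∀ v : ℝ,
    Integrable (fun u : Fin n → ℝ ↦
      (∏ i, (1 + ‖u i‖) ^ (-1 : ℝ)) * (1 + ‖v - ∑ i, u i‖) ^ (-r)) := by
  induction n with
  | zero =>
    intro r _ _ v
    simp [volume_pi]
  | succ n ih =>
    intro r hr hr1 v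
    obtain ⟨C, hC⟩ := exists_integral_rpow_conv_le hr hr1
    rw [← (volume_preserving_piFinSuccAbove (fun _ : Fin (n + 1) ↦ ℝ) 0).symm.integrable_comp_emb
      (MeasurableEquiv.measurableEmbedding _)]
    have hm : AEStronglyMeasurable (fun z : ℝ × (Fin n → ℝ) ↦
        (∏ i, (1 + ‖z.2 i‖) ^ (-1 : ℝ)) *
          ((1 + ‖z.1‖) ^ (-1 : ℝ) * (1 + ‖(v - ∑ i, z.2 i) - z.1‖) ^ (-r)))
        (volume.prod volume) :=
      Measurable.aestronglyMeasurable (by fun_prop)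
    have hz : Integrable (fun z : ℝ × (Fin n → ℝ) ↦
        (∏ i, (1 + ‖z.2 i‖) ^ (-1 : ℝ)) *
          ((1 + ‖z.1‖) ^ (-1 : ℝ) * (1 + ‖(v - ∑ i, z.2 i) - z.1‖) ^ (-r))) (volume.prod volume) := by
      refine (integrable_prod_iff' hm).2 ⟨ae_of_all _ fun u ↦ (hC (v - ∑ i, u i)).1.const_mul (∏ i, (1 + ‖u i‖) ^ (-1 : ℝ)), ?_⟩
      refine ((ih (r := r / 3) (by positivity) (by linarith) v).const_mul C).mono'
        hm.norm.prod_swap.integral_prod_right' (ae_of_all _ fun u ↦ ?_)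
      rw [Real.norm_of_nonneg (integral_nonneg fun _ ↦ norm_nonneg _)]
      have : ∀ x : ℝ, ‖(∏ i, (1 + ‖u i‖) ^ (-1 : ℝ)) *
          ((1 + ‖x‖) ^ (-1 : ℝ) * (1 + ‖(v - ∑ i, u i) - x‖) ^ (-r))‖ =
          (∏ i, (1 + ‖u i‖) ^ (-1 : ℝ)) *
          ((1 + ‖x‖) ^ (-1 : ℝ) * (1 + ‖(v - ∑ i, u i) - x‖) ^ (-r)) := fun x ↦
        Real.norm_of_nonneg (by positivity)
      simp only [this]
      rw [integral_const_mul, mul_left_comm]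
      gcongr
      exact (hC _).2
    refine hz.congr (ae_of_all _ fun z ↦ ?_)
    simp [MeasurableEquiv.piFinSuccAbove, Fin.prod_univ_succ, Fin.sum_univ_succ, sub_add_eq_sub_sub_swap]
    ring


lemma continuous_fourier_of_integrable {f : ℝ → ℂ} (hf : Integrable f) : Continuous (𝓕 f) :=
  VectorFourier.fourierIntegral_continuous Real.continuous_fourierChar continuous_inner hf

lemma norm_fourier_le_integral_norm (f : ℝ → ℂ) (w : ℝ) : ‖𝓕 f w‖ ≤ ∫ t, ‖f t‖ :=
  VectorFourier.norm_fourierIntegral_le_integral_norm _ _ _ f w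

lemma integrable_prod_fourier {p q : ℝ → ℂ} (hp : Integrable p) (hq : Integrable q) {C D r : ℝ}
    (hC : ∀ w, ‖𝓕 p w‖ ≤ C * (1 + ‖w‖) ^ (-1 : ℝ)) (hr : 0 < r) (hr1 : r ≤ 1)
    (hD : ∀ w, ‖𝓕 q w‖ ≤ D * (1 + ‖w‖) ^ (-r)) (n : ℕ) (v : ℝ) :
    Integrable (fun u : Fin n → ℝ ↦ (∏ i, 𝓕 p (u i)) * 𝓕 q (v - ∑ i, u i)) := by
  have hp' := continuous_fourier_of_integrable hp
  have hq' := continuous_fourier_of_integrable hq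
  have hC0 : 0 ≤ C := by simpa using (norm_nonneg _).trans (hC 0)
  refine ((integrable_prod_rpow_neg n hr hr1 v).const_mul (C ^ n * D)).mono'
    (Continuous.aestronglyMeasurable (by fun_prop)) (ae_of_all _ fun u ↦ ?_)
  calc ‖(∏ i, 𝓕 p (u i)) * 𝓕 q (v - ∑ i, u i)‖
      = (∏ i, ‖𝓕 p (u i)‖) * ‖𝓕 q (v - ∑ i, u i)‖ := by rw [norm_mul, norm_prod]
    _ ≤ (∏ i, C * (1 + ‖u i‖) ^ (-1 : ℝ)) * (D * (1 + ‖v - ∑ i, u i‖) ^ (-r)) := by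
        gcongr
        · exact hC _
        · exact hD _
    _ = _ := by
        rw [Finset.prod_mul_distrib, Finset.prod_const, Finset.card_univ, Fintype.card_fin]
        ring

/-- The Fourier transform of a product is the convolution of the Fourier transforms. -/
lemma integral_fourier_mul_fourier_sub {p q : ℝ → ℂ} (hp : Continuous p)
    (hps : HasCompactSupport p) (hq : Continuous q) (hqs : HasCompactSupport q) (v : ℝ)
    (hint : Integrable (fun u : ℝ ↦ 𝓕 p u * 𝓕 q (v - u))) :
    ∫ u : ℝ, 𝓕 p u * 𝓕 q (v - u) = 𝓕 (p * q) v := by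
  set s : ℝ → ℂ := fun t ↦ Real.fourierChar (t * v) • q (-t) with hs
  have hpi : Integrable p := hp.integrable_of_hasCompactSupport hps
  have hs_cont : Continuous s := by
    simp only [hs, Circle.smul_def]
    have := Real.continuous_fourierChar
    fun_prop
  have hs_supp : HasCompactSupport s := by
    have h := (hqs.comp_homeomorph (Homeomorph.neg ℝ))
    exact h.smul_left
  have hsi : Integrable s := hs_cont.integrable_of_hasCompactSupport hs_supp
  have hsF : ∀ u, 𝓕 s u = 𝓕 q (v - u) := fun u ↦ by
    rw [Real.fourier_real_eq, Real.fourier_real_eq, ← integral_neg_eq_self]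
    congr 1
    ext t
    simp only [hs, smul_smul, ← AddChar.map_add_eq_mul, neg_neg]
    congr 2
    ring
  have hconvF : 𝓕 (p ⋆[ContinuousLinearMap.mul ℂ ℂ, volume] s) =
      fun u : ℝ ↦ 𝓕 p u * 𝓕 q (v - u) := by
    ext u
    rw [Real.fourier_mul_convolution_eq hpi hsi, hsF]
  have hcc : Continuous (p ⋆[ContinuousLinearMap.mul ℂ ℂ, volume] s) :=
    hs_supp.continuous_convolution_right _ hpi.locallyIntegrable hs_cont
  have hcs : HasCompactSupport (p ⋆[ContinuousLinearMap.mul ℂ ℂ, volume] s) :=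
    hps.convolution _ hs_supp
  have hinv := congrFun (hcc.fourierInv_fourier_eq (hcc.integrable_of_hasCompactSupport hcs)
    (by rw [hconvF]; exact hint)) 0
  rw [Real.fourierInv_eq, hconvF] at hinv
  simp only [inner_zero_right, AddChar.map_zero_eq_one, one_smul] at hinv
  rw [hinv, convolution_def, Real.fourier_real_eq]
  congr 1
  ext t
  simp only [hs, zero_sub, neg_neg, neg_mul, ContinuousLinearMap.mul_apply', Pi.mul_apply,
    Circle.smul_def, smul_eq_mul]
  ring

/-- Iterated convolution of Fourier transforms: the transform of `p ^ n * q` as an integral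
over `ℝⁿ`. -/
theorem integral_prod_fourier {p : ℝ → ℂ} (hp : Continuous p) (hps : HasCompactSupport p) {C : ℝ}
    (hC : ∀ w, ‖𝓕 p w‖ ≤ C * (1 + ‖w‖) ^ (-1 : ℝ)) (n : ℕ) :
    ∀ {q : ℝ → ℂ}, Continuous q → HasCompactSupport q → ∀ {D r : ℝ}, 0 < r → r ≤ 1 →
      (∀ w, ‖𝓕 q w‖ ≤ D * (1 + ‖w‖) ^ (-r)) → ∀ v : ℝ,
      ∫ u : Fin n → ℝ, (∏ i, 𝓕 p (u i)) * 𝓕 q (v - ∑ i, u i) = 𝓕 (p ^ n * q) v := by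
  have hpi : Integrable p := hp.integrable_of_hasCompactSupport hps
  induction n with
  | zero =>
    intro q _ _ D r _ _ _ v
    simp [volume_pi, measureReal_def]
  | succ n ih =>
    intro q hq hqs D r hr hr1 hD v
    have hqi : Integrable q := hq.integrable_of_hasCompactSupport hqs
    have hI := integrable_prod_fourier hpi hqi hC hr hr1 hD
    have hone : ∀ x, ∫ u : ℝ, 𝓕 p u * 𝓕 q (x - u) = 𝓕 (p * q) x := fun x ↦ by
      refine integral_fourier_mul_fourier_sub hp hps hq hqs x ?_
      rw [← (volume_preserving_funUnique (Fin 1) ℝ).integrable_comp_emb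
        (MeasurableEquiv.measurableEmbedding _)]
      refine (hI 1 x).congr (ae_of_all _ fun u ↦ ?_)
      simp
    obtain ⟨B, hB⟩ := exists_integral_rpow_conv_le hr hr1
    have hC0 : 0 ≤ C := by simpa using (norm_nonneg _).trans (hC 0)
    have hD0 : 0 ≤ D := by simpa using (norm_nonneg _).trans (hD 0)
    have hdecay : ∀ w, ‖𝓕 (p * q) w‖ ≤ C * D * B * (1 + ‖w‖) ^ (-(r / 3)) := fun w ↦ by
      rw [← hone]
      calc ‖∫ u : ℝ, 𝓕 p u * 𝓕 q (w - u)‖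
          ≤ ∫ u : ℝ, C * D * ((1 + ‖u‖) ^ (-1 : ℝ) * (1 + ‖w - u‖) ^ (-r)) := by
            refine norm_integral_le_of_norm_le ((hB w).1.const_mul _) (ae_of_all _ fun u ↦ ?_)
            rw [norm_mul, mul_mul_mul_comm]
            gcongr
            · exact hC _
            · exact hD _
        _ ≤ _ := by
            rw [integral_const_mul, mul_assoc (C * D)]
            gcongr
            exact (hB w).2
    have key := ih (hp.mul hq) (hps.mul_right (f' := q)) (r := r / 3) (by positivity) (by linarith)
      hdecay v
    have hsplit : ∀ z : ℝ × (Fin n → ℝ),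
        (∏ i, 𝓕 p ((MeasurableEquiv.piFinSuccAbove (fun _ ↦ ℝ) 0).symm z i)) *
          𝓕 q (v - ∑ i, (MeasurableEquiv.piFinSuccAbove (fun _ ↦ ℝ) 0).symm z i) =
        (∏ i, 𝓕 p (z.2 i)) * (𝓕 p z.1 * 𝓕 q ((v - ∑ i, z.2 i) - z.1)) := fun z ↦ by
      simp [MeasurableEquiv.piFinSuccAbove, Fin.prod_univ_succ, Fin.sum_univ_succ,
        sub_add_eq_sub_sub_swap]
      ring
    have hmp := (volume_preserving_piFinSuccAbove (fun _ : Fin (n + 1) ↦ ℝ) 0).symm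
    have hint := (hmp.integrable_comp_emb (MeasurableEquiv.measurableEmbedding _)).2 (hI (n + 1) v)
    rw [← hmp.integral_comp (MeasurableEquiv.measurableEmbedding _)]
    simp only [Function.comp_def, hsplit] at hint ⊢
    rw [Measure.volume_eq_prod] at hint ⊢
    rw [integral_prod_symm _ hint]
    simp only [integral_const_mul, hone]
    rw [pow_succ, mul_assoc]
    exact key

/-- The `L¹` modulus of continuity of a function of bounded variation is linear. -/
lemma integral_norm_sub_comp_add_le {f : ℝ → ℂ} (hf : Continuous f) {A : ℝ} (hA : 0 ≤ A)
    (hfs : ∀ t, t ∉ Set.Icc 0 A → f t = 0) (hbv : BoundedVariationOn f Set.univ) {s : ℝ}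
    (hs : 0 ≤ s) :
    ∫ t, ‖f t - f (t + s)‖ ≤ (eVariationOn f Set.univ).toReal * s := by
  set V := (eVariationOn f Set.univ).toReal
  set v : ℝ → ℝ := fun t ↦ (eVariationOn f (Set.Iic t)).toReal with hv
  have hfin : ∀ S : Set ℝ, eVariationOn f S ≠ ⊤ := fun S ↦ hbv.mono (Set.subset_univ S)
  have hvV : ∀ t, v t ≤ V := fun t ↦
    ENNReal.toReal_mono hbv (eVariationOn.mono f (Set.subset_univ _))
  have hv0 : ∀ t, 0 ≤ v t := fun t ↦ ENNReal.toReal_nonneg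
  have hmono : Monotone v := fun x y hxy ↦
    ENNReal.toReal_mono (hfin _) (eVariationOn.mono f (Set.Iic_subset_Iic.2 hxy))
  have hvi : ∀ a b : ℝ, IntervalIntegrable v volume a b := fun a b ↦ hmono.intervalIntegrable
  have hsub : ∀ t, ‖f t - f (t + s)‖ ≤ v (t + s) - v t := fun t ↦ by
    have h1 : eVariationOn f (Set.Iic t) + eVariationOn f (Set.Icc t (t + s)) ≤
        eVariationOn f (Set.Iic (t + s)) :=
      (eVariationOn.add_le_union f fun x hx y hy ↦ le_trans hx hy.1).trans
        (eVariationOn.mono f (Set.union_subset (Set.Iic_subset_Iic.2 (by linarith))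
          fun y hy ↦ hy.2))
    have h2 := eVariationOn.edist_le f (s := Set.Icc t (t + s)) (x := t) (y := t + s)
      ⟨le_rfl, by linarith⟩ ⟨by linarith, le_rfl⟩
    have h3 := ENNReal.toReal_mono (hfin _) ((add_le_add_right h2 _).trans h1)
    rw [ENNReal.toReal_add (hfin _) (edist_ne_top _ _), edist_dist,
      ENNReal.toReal_ofReal dist_nonneg, dist_eq_norm] at h3
    simp only [hv]
    linarith
  have hzero : ∀ t, t ∉ Set.Ioc (-s - 1) A → ‖f t - f (t + s)‖ = 0 := fun t ht ↦ by
    rw [hfs t, hfs (t + s), sub_zero, norm_zero]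
    · exact fun h ↦ ht ⟨by linarith [h.1], by linarith [h.2]⟩
    · exact fun h ↦ ht ⟨by linarith [h.1], h.2⟩
  have hcont : Continuous fun t ↦ ‖f t - f (t + s)‖ := by fun_prop
  have hvs : IntervalIntegrable (fun t ↦ v (t + s)) volume (-s - 1) A :=
    Monotone.intervalIntegrable fun x y hxy ↦ hmono (by linarith)
  have hupper : ∫ t in A..(A + s), v t ≤ V * s := by
    have := intervalIntegral.integral_mono_on (by linarith) (hvi A (A + s))
      (intervalIntegrable_const (c := V)) fun t _ ↦ hvV t
    simpa [mul_comm] using this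
  have hlower : 0 ≤ ∫ t in (-s - 1)..(-1), v t :=
    intervalIntegral.integral_nonneg (by linarith) fun t _ ↦ hv0 t
  have e1 := intervalIntegral.integral_add_adjacent_intervals (hvi (-1) A) (hvi A (A + s))
  have e2 := intervalIntegral.integral_add_adjacent_intervals (hvi (-s - 1) (-1)) (hvi (-1) A)
  calc ∫ t, ‖f t - f (t + s)‖ = ∫ t in (-s - 1)..A, ‖f t - f (t + s)‖ := by
        rw [intervalIntegral.integral_of_le (by linarith),
          setIntegral_eq_integral_of_forall_compl_eq_zero hzero]
    _ ≤ ∫ t in (-s - 1)..A, (v (t + s) - v t) :=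
        intervalIntegral.integral_mono_on (by linarith) (hcont.intervalIntegrable _ _)
          (hvs.sub (hvi _ _)) fun t _ ↦ hsub t
    _ = (∫ t in A..(A + s), v t) - ∫ t in (-s - 1)..(-1), v t := by
        rw [intervalIntegral.integral_sub hvs (hvi _ _),
          intervalIntegral.integral_comp_add_right, show -s - 1 + s = -1 by ring, ← e1, ← e2]
        ring
    _ ≤ V * s := by linarith

/-- The Fourier transform of a function of bounded variation decays like `(1 + ‖w‖)⁻¹`. -/
lemma exists_norm_fourier_le {f : ℝ → ℂ} (hf : Continuous f) {A : ℝ} (hA : 0 ≤ A)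
    (hfs : ∀ t, t ∉ Set.Icc 0 A → f t = 0) (hbv : BoundedVariationOn f Set.univ) :
    ∃ C : ℝ, ∀ w, ‖𝓕 f w‖ ≤ C * (1 + ‖w‖) ^ (-1 : ℝ) := by
  have hfi : Integrable f :=
    hf.integrable_of_hasCompactSupport (HasCompactSupport.intro isCompact_Icc hfs)
  set V := (eVariationOn f Set.univ).toReal
  have hV0 : 0 ≤ V := ENNReal.toReal_nonneg
  have htrans : ∀ s : ℝ, ∫ t, ‖f t - f (t + s)‖ ≤ V * |s| := fun s ↦ by
    rcases le_total 0 s with hs | hs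
    · rw [abs_of_nonneg hs]
      exact integral_norm_sub_comp_add_le hf hA hfs hbv hs
    · rw [abs_of_nonpos hs, ← integral_add_right_eq_self _ (-s)]
      simpa [norm_sub_rev] using integral_norm_sub_comp_add_le hf hA hfs hbv (neg_nonneg.2 hs)
  have hdecay : ∀ w : ℝ, ‖w‖ * ‖𝓕 f w‖ ≤ V := fun w ↦ by
    rcases eq_or_ne w 0 with rfl | hw
    · simpa using hV0
    have hw' : 0 < |w| := abs_pos.2 hw
    have h1 : 𝓕 f w = _ := fourierIntegral_eq_half_sub_half_period_translate hw hfi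
    have h2 : ‖𝓕 f w‖ ≤ 1 / 2 * (V * |(1 / (2 * ‖w‖ ^ 2)) • w|) := by
      rw [h1, norm_smul]
      gcongr
      · simp
      · refine (norm_integral_le_integral_norm _).trans ?_
        simp only [Circle.norm_smul]
        exact htrans _
    have h3 : |(1 / (2 * ‖w‖ ^ 2)) • w| = 1 / (2 * |w|) := by
      rw [smul_eq_mul, abs_mul, Real.norm_eq_abs, abs_of_pos (by positivity)]
      field_simp
    rw [h3] at h2
    calc ‖w‖ * ‖𝓕 f w‖ ≤ |w| * (1 / 2 * (V * (1 / (2 * |w|)))) := by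
          rw [Real.norm_eq_abs]; gcongr
      _ = V / 4 := by field_simp; ring
      _ ≤ V := by linarith
  refine ⟨(∫ t, ‖f t‖) + V, fun w ↦ ?_⟩
  rw [Real.rpow_neg_one, ← div_eq_mul_inv, le_div_iff₀ (by positivity)]
  linarith [hdecay w, norm_fourier_le_integral_norm f w]

lemma H1T_two_pi_mul {h : ℝ → ℝ} {T : ℝ} (hT : 0 < T)
    (hs : ∀ t, t ∉ Set.Icc 0 T → h (t / T) = 0) (x : ℝ) :
    H1T h T (2 * Real.pi * x) = 𝓕 (fun t : ℝ ↦ (h (t / T) : ℂ)) x := by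
  rw [H1T, Real.fourier_real_eq_integral_exp_smul, intervalIntegral.integral_of_le hT.le,
    ← integral_Icc_eq_integral_Ioc, setIntegral_eq_integral_of_forall_compl_eq_zero]
  · congr 1
    ext t
    rw [smul_eq_mul, mul_comm]
    congr 2
    push_cast
    ring
  · intro t ht
    simp [hs t ht]

lemma fourier_pow_zero {h : ℝ → ℝ} {T : ℝ} (hT : 0 < T)
    (hs : ∀ t, t ∉ Set.Icc 0 T → h (t / T) = 0) {k : ℕ} (hk : k ≠ 0) :
    𝓕 ((fun t : ℝ ↦ (h (t / T) : ℂ)) ^ k) 0 = ((T * Hcoef h k : ℝ) : ℂ) := by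
  have h1 : ∫ t in (0 : ℝ)..T, h (t / T) ^ k = T * Hcoef h k := by
    rw [intervalIntegral.integral_comp_div (fun t ↦ h t ^ k) hT.ne', zero_div, div_self hT.ne',
      smul_eq_mul, Hcoef]
  rw [← h1, Real.fourier_real_eq, intervalIntegral.integral_of_le hT.le,
    ← integral_Icc_eq_integral_Ioc, setIntegral_eq_integral_of_forall_compl_eq_zero]
  · rw [← integral_complex_ofReal]
    simp
  · intro t ht
    simp [hs t ht, hk]

/-- The Fejér-type tapered kernel integrates to one. -/
theorem fejerKer_integral_eq_one (h : ℝ → ℝ) (hh : IsTaper h) (k : ℕ) (hk : 2 ≤ k) :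
    ∀ T : ℝ, 0 < T → (∫ u : Fin (k - 1) → ℝ, fejerKer h k T u) = 1 := by
  intro T hT
  obtain ⟨hcont, -, hbv, hsupp, hpos⟩ := hh
  have hs : ∀ t, t ∉ Set.Icc 0 T → h (t / T) = 0 := fun t ht ↦ by
    by_contra hne
    have := hsupp hne
    exact ht ⟨by simpa using (le_div_iff₀ hT).1 this.1, by simpa using (div_le_iff₀ hT).1 this.2⟩
  set p : ℝ → ℂ := fun t ↦ (h (t / T) : ℂ) with hp
  have hp_cont : Continuous p := by fun_prop
  have hp_zero : ∀ t, t ∉ Set.Icc 0 T → p t = 0 := fun t ht ↦ by simp [hp, hs t ht]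
  have hp_supp : HasCompactSupport p := HasCompactSupport.intro isCompact_Icc hp_zero
  have hp_bv : BoundedVariationOn p Set.univ := by
    have h1 : BoundedVariationOn (fun t ↦ h (t / T)) Set.univ := ne_top_of_le_ne_top hbv
      (eVariationOn.comp_le_of_monotoneOn h (fun t ↦ t / T)
        (fun x _ y _ hxy ↦ div_le_div_of_nonneg_right hxy hT.le) fun _ _ ↦ Set.mem_univ _)
    exact Complex.isometry_ofReal.lipschitz.comp_boundedVariationOn h1
  obtain ⟨C, hC⟩ := exists_norm_fourier_le hp_cont hT.le hp_zero hp_bv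
  have hpi : Integrable p := hp_cont.integrable_of_hasCompactSupport hp_supp
  obtain ⟨n, rfl⟩ : ∃ n, k = n + 1 := ⟨k - 1, by omega⟩
  change ∫ u : Fin n → ℝ, fejerKer h (n + 1) T u = 1
  have hH : 0 < Hcoef h (n + 1) := hpos _ (by omega)
  have hint := integrable_prod_fourier hpi hpi hC one_pos le_rfl hC n 0
  have hval := integral_prod_fourier hp_cont hp_supp hC n hp_cont hp_supp one_pos le_rfl hC 0
  rw [← pow_succ, fourier_pow_zero hT hs n.succ_ne_zero] at hval
  set c : ℝ := (2 * Real.pi) ^ n * (T * Hcoef h (n + 1)) with hc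
  have hker : ∀ x : Fin n → ℝ, fejerKer h (n + 1) T ((2 * Real.pi) • x) =
      Complex.reCLM (((∏ i, 𝓕 p (x i)) * 𝓕 p (0 - ∑ i, x i)) / (c : ℂ)) := fun x ↦ by
    have hsum : -(∑ i, ((2 * Real.pi) • x) i) = 2 * Real.pi * (0 - ∑ i, x i) := by
      simp [Finset.mul_sum]
    change (((∏ i : Fin n, H1T h T (((2 * Real.pi) • x) i)) *
      H1T h T (-(∑ i : Fin n, ((2 * Real.pi) • x) i))) / (c : ℂ)).re = _
    rw [hsum, H1T_two_pi_mul hT hs]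
    simp only [Pi.smul_apply, smul_eq_mul, H1T_two_pi_mul hT hs]
    rfl
  have hscale := Measure.integral_comp_smul (volume : Measure (Fin n → ℝ))
    (fejerKer h (n + 1) T) (2 * Real.pi)
  simp only [hker] at hscale
  rw [Complex.reCLM.integral_comp_comm (hint.div_const _), integral_div, hval,
    ← Complex.ofReal_div, Complex.reCLM_apply, Complex.ofReal_re, Module.finrank_fin_fun,
    abs_of_pos (by positivity), smul_eq_mul, hc] at hscale
  have hpi0 : (2 * Real.pi) ^ n ≠ 0 := by positivity
  have hTH : T * Hcoef h (n + 1) ≠ 0 := by positivity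
  field_simp at hscale
  simpa using hscale.symm
end
end

section
/- For every integer k ≥ 2, every taper h, and every δ > 0, the mass of the Fejér-type tapered kernel outside the cube E_δ := {u ∈ ℝ^{k−1} : |u_i| ≤ δ, i = 1,…,k−1} vanishes: lim_{T→∞} ∫_{ℝ^{k−1} \ E_δ} |F^h_{k,T}(u)| du = 0. -/
open MeasureTheory Filter Topology
open scoped ENNReal NNReal

noncomputable section

lemma IsTaper.hasCompactSupport {h : ℝ → ℝ} (hh : IsTaper h) : HasCompactSupport h :=
  HasCompactSupport.of_support_subset_isCompact isCompact_Icc hh.2.2.2.1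

lemma IsTaper.eq_zero {h : ℝ → ℝ} (hh : IsTaper h) {t : ℝ} (ht : t ∉ Set.Icc (0 : ℝ) 1) :
    h t = 0 := by
  by_contra hne
  exact ht (hh.2.2.2.1 hne)

/-- The `L¹` modulus of continuity of a taper is at most linear. -/
lemma IsTaper.exists_integral_abs_sub_shift_le {h : ℝ → ℝ} (hh : IsTaper h) :
    ∃ D : ℝ, ∀ s : ℝ, 0 ≤ s → s ≤ Real.pi → ∫ t, |h t - h (t + s)| ≤ s * D := by
  obtain ⟨p, q, hp, hq, hpq⟩ :=
    hh.2.2.1.locallyBoundedVariationOn.exists_monotoneOn_sub_monotoneOn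
  rw [monotoneOn_univ] at hp hq
  have hM : Monotone (p + q) := hp.add hq
  set M := p + q with hMdef
  refine ⟨M (1 + Real.pi) - M (-Real.pi), fun s hs0 hsπ => ?_⟩
  have hsupp : ∀ t, t ∉ Set.Icc (-s) 1 → |h t - h (t + s)| = 0 := by
    intro t ht
    have h1 : t ∉ Set.Icc (0 : ℝ) 1 := fun h' => ht ⟨by linarith [h'.1], h'.2⟩
    have h2 : t + s ∉ Set.Icc (0 : ℝ) 1 := fun h' => ht ⟨by linarith [h'.1], by linarith [h'.2]⟩
    rw [hh.eq_zero h1, hh.eq_zero h2]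
    simp
  have hle : ∀ t, |h t - h (t + s)| ≤ M (t + s) - M t := by
    intro t
    have h1 := hp (show t ≤ t + s by linarith)
    have h2 := hq (show t ≤ t + s by linarith)
    simp only [hpq, hMdef, Pi.sub_apply, Pi.add_apply]
    rw [abs_le]
    constructor <;> linarith
  have hMi : ∀ a b, IntervalIntegrable M volume a b := fun a b => hM.intervalIntegrable
  have hMs : IntervalIntegrable (fun t => M (t + s)) volume (-s) 1 :=
    Monotone.intervalIntegrable fun a b hab => hM (by linarith)
  have hcont : Continuous fun t => |h t - h (t + s)| := by
    have := hh.1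
    fun_prop
  rw [← setIntegral_eq_integral_of_forall_compl_eq_zero hsupp, integral_Icc_eq_integral_Ioc,
    ← intervalIntegral.integral_of_le (by linarith)]
  calc ∫ t in (-s)..1, |h t - h (t + s)|
      ≤ ∫ t in (-s)..1, (M (t + s) - M t) :=
        intervalIntegral.integral_mono_on (by linarith) (hcont.intervalIntegrable _ _)
          (hMs.sub (hMi _ _)) fun t _ => hle t
    _ = (∫ t in (1 : ℝ)..(1 + s), M t) - ∫ t in (-s)..0, M t := by
        rw [intervalIntegral.integral_sub hMs (hMi _ _), intervalIntegral.integral_comp_add_right,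
          neg_add_cancel,
          intervalIntegral.integral_interval_sub_interval_comm' (hMi _ _) (hMi _ _) (hMi _ _)]
    _ ≤ (∫ t in (1 : ℝ)..(1 + s), M (1 + Real.pi)) - ∫ t in (-s)..0, M (-Real.pi) := by
        refine sub_le_sub ?_ ?_
        · exact intervalIntegral.integral_mono_on (by linarith) (hMi _ _)
            intervalIntegrable_const fun t ht => hM (by linarith [ht.2])
        · exact intervalIntegral.integral_mono_on (by linarith) intervalIntegrable_const
            (hMi _ _) fun t ht => hM (by linarith [ht.1])
    _ = s * (M (1 + Real.pi) - M (-Real.pi)) := by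
        simp only [intervalIntegral.integral_const, smul_eq_mul]
        ring

lemma norm_ofReal_mul_exp (a l t : ℝ) :
    ‖(a : ℂ) * Complex.exp (-Complex.I * (l : ℂ) * (t : ℂ))‖ = |a| := by
  have : -Complex.I * (l : ℂ) * (t : ℂ) = ((-(l * t) : ℝ) : ℂ) * Complex.I := by
    push_cast
    ring
  rw [norm_mul, this, Complex.norm_exp_ofReal_mul_I, mul_one, Complex.norm_real, Real.norm_eq_abs]

lemma H1T_eq_integral {h : ℝ → ℝ} (hh : IsTaper h) {T : ℝ} (hT : 0 < T) (l : ℝ) :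
    H1T h T l =
      T * ∫ t : ℝ, (h t : ℂ) * Complex.exp (-Complex.I * ((T * l : ℝ) : ℂ) * (t : ℂ)) := by
  have h1 : H1T h T l = ∫ t in (0 : ℝ)..T,
      (fun x : ℝ => (h x : ℂ) * Complex.exp (-Complex.I * ((T * l : ℝ) : ℂ) * (x : ℂ)))
        (t / T) := by
    unfold H1T
    congr 1
    funext t
    have hT' : (T : ℂ) ≠ 0 := by exact_mod_cast hT.ne'
    congr 2
    push_cast
    field_simp
  rw [h1, intervalIntegral.integral_comp_div (fun x : ℝ =>
      (h x : ℂ) * Complex.exp (-Complex.I * ((T * l : ℝ) : ℂ) * (x : ℂ))) hT.ne',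
    zero_div, div_self hT.ne',
    intervalIntegral.integral_of_le zero_le_one, ← integral_Icc_eq_integral_Ioc,
    setIntegral_eq_integral_of_forall_compl_eq_zero, Complex.real_smul]
  intro t ht
  rw [hh.eq_zero ht]
  simp

/-- A taper has a Fourier transform of order `1 / (1 + |x|)`. -/
lemma IsTaper.exists_norm_fourier_le {h : ℝ → ℝ} (hh : IsTaper h) :
    ∃ C : ℝ, 0 ≤ C ∧ ∀ x : ℝ,
      ‖∫ t : ℝ, (h t : ℂ) * Complex.exp (-Complex.I * (x : ℂ) * (t : ℂ))‖ ≤ C * (1 + |x|)⁻¹ := by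
  obtain ⟨D, hD⟩ := hh.exists_integral_abs_sub_shift_le
  have hpi := Real.pi_pos
  have hD0 : 0 ≤ D := by
    have h1 := hD Real.pi hpi.le le_rfl
    have h2 : 0 ≤ ∫ t, |h t - h (t + Real.pi)| := integral_nonneg fun t => abs_nonneg _
    exact nonneg_of_mul_nonneg_right (h2.trans h1) hpi
  set A := ∫ t, |h t| with hA
  have hA0 : 0 ≤ A := integral_nonneg fun t => abs_nonneg _
  have hint : ∀ x : ℝ,
      Integrable fun t : ℝ => (h t : ℂ) * Complex.exp (-Complex.I * (x : ℂ) * (t : ℂ)) := by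
    intro x
    have hc := hh.1
    refine Continuous.integrable_of_hasCompactSupport (by fun_prop) ?_
    exact (hh.hasCompactSupport.comp_left (g := fun y : ℝ => (y : ℂ)) (by simp)).mul_right
  refine ⟨2 * A + Real.pi * D, by positivity, fun x => ?_⟩
  rw [← div_eq_mul_inv, le_div_iff₀ (by positivity)]
  set f := ∫ t : ℝ, (h t : ℂ) * Complex.exp (-Complex.I * (x : ℂ) * (t : ℂ)) with hf
  have hfA : ‖f‖ ≤ A := by
    refine (norm_integral_le_integral_norm _).trans_eq ?_
    simp only [norm_ofReal_mul_exp, hA]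
  rcases le_total |x| 1 with hx | hx
  · nlinarith [mul_nonneg hpi.le hD0, norm_nonneg f]
  have hx0 : 0 < |x| := by linarith
  set s := Real.pi / |x| with hs
  have hs0 : 0 ≤ s := by positivity
  have hsπ : s ≤ Real.pi := div_le_self hpi.le hx
  have hexp : Complex.exp (-Complex.I * (x : ℂ) * (s : ℂ)) = -1 := by
    rcases abs_cases x with ⟨h1, -⟩ | ⟨h1, -⟩
    · have : x * s = Real.pi := by rw [hs, mul_div_assoc', div_eq_iff hx0.ne', h1, mul_comm]
      rw [show -Complex.I * (x : ℂ) * (s : ℂ) = -(((x * s : ℝ) : ℂ) * Complex.I) by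
        push_cast; ring, this, Complex.exp_neg, Complex.exp_pi_mul_I]
      norm_num
    · have : x * s = -Real.pi := by
        rw [hs, mul_div_assoc', div_eq_iff hx0.ne', h1]
        ring
      rw [show -Complex.I * (x : ℂ) * (s : ℂ) = -(((x * s : ℝ) : ℂ) * Complex.I) by
        push_cast; ring, this]
      simp [Complex.exp_pi_mul_I]
  have hshift : ∀ t : ℝ,
      (h (t + s) : ℂ) * Complex.exp (-Complex.I * (x : ℂ) * ((t + s : ℝ) : ℂ)) =
        -((h (t + s) : ℂ) * Complex.exp (-Complex.I * (x : ℂ) * (t : ℂ))) := by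
    intro t
    rw [Complex.ofReal_add, mul_add, Complex.exp_add, hexp]
    ring
  have hfs : f = -∫ t : ℝ, (h (t + s) : ℂ) * Complex.exp (-Complex.I * (x : ℂ) * (t : ℂ)) := by
    rw [hf, ← integral_add_right_eq_self _ s, ← integral_neg]
    exact integral_congr_ae (Eventually.of_forall hshift)
  have hint2 : Integrable
      fun t : ℝ => (h (t + s) : ℂ) * Complex.exp (-Complex.I * (x : ℂ) * (t : ℂ)) := by
    refine (((hint x).comp_add_right s).neg).congr (Eventually.of_forall fun t => ?_)
    simp only [Pi.neg_apply]
    rw [hshift, neg_neg]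
  have h2f : 2 * f =
      ∫ t : ℝ, ((h t - h (t + s) : ℝ) : ℂ) * Complex.exp (-Complex.I * (x : ℂ) * (t : ℂ)) := by
    simp only [Complex.ofReal_sub, sub_mul]
    rw [integral_sub (hint x) hint2, ← hf, two_mul, sub_eq_add_neg, ← hfs]
  have h2n : 2 * ‖f‖ ≤ s * D := by
    have : 2 * ‖f‖ = ‖2 * f‖ := by simp
    rw [this, h2f]
    refine (norm_integral_le_integral_norm _).trans ?_
    simp only [norm_ofReal_mul_exp]
    exact hD s hs0 hsπ
  have hsx : s * |x| = Real.pi := div_mul_cancel₀ _ hx0.ne'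
  have h3 : 2 * ‖f‖ * |x| ≤ Real.pi * D := by
    calc 2 * ‖f‖ * |x| ≤ s * D * |x| := by gcongr
      _ = Real.pi * D := by rw [← hsx]; ring
  nlinarith [norm_nonneg f]

/-- A product majorant for the Fejér-type kernel at unit scale. -/
def fejerMajorant (n : ℕ) (v : Fin n → ℝ) : ℝ :=
  (∏ i, (1 + |v i|)⁻¹) * (1 + |∑ i, v i|)⁻¹

lemma fejerMajorant_nonneg (n : ℕ) (v : Fin n → ℝ) : 0 ≤ fejerMajorant n v := by
  unfold fejerMajorant
  positivity

lemma continuous_fejerMajorant (n : ℕ) : Continuous (fejerMajorant n) := by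
  have h1 : ∀ f : (Fin n → ℝ) → ℝ, Continuous f → Continuous fun v => (1 + |f v|)⁻¹ :=
    fun f hf => (continuous_const.add hf.abs).inv₀ fun v =>
      (add_pos_of_pos_of_nonneg one_pos (abs_nonneg (f v))).ne'
  unfold fejerMajorant
  exact (continuous_finsetProd _ fun i _ => h1 _ (continuous_apply i)).mul
    (h1 _ (continuous_finsetSum _ fun i _ => continuous_apply i))

lemma mul_prod_le_prod_rpow {n : ℕ} (hn : 1 ≤ n) (a : Fin n → ℝ) (ha : ∀ i, 0 < a i) {x : ℝ}
    (hx : 0 < x) (hxa : ∀ i, x ≤ a i) :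
    (∏ i, a i) * x ≤ ∏ i, a i ^ (1 + (n : ℝ)⁻¹) := by
  have hn' : (n : ℝ) ≠ 0 := by positivity
  have hx' : x = ∏ _i : Fin n, x ^ (n : ℝ)⁻¹ := by
    rw [Finset.prod_const, Finset.card_univ, Fintype.card_fin, ← Real.rpow_natCast,
      ← Real.rpow_mul hx.le, inv_mul_cancel₀ hn', Real.rpow_one]
  rw [hx', ← Finset.prod_mul_distrib]
  refine Finset.prod_le_prod (fun i _ => by have := ha i; positivity) fun i _ => ?_
  rw [Real.rpow_add (ha i), Real.rpow_one]
  have := ha i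
  have := hxa i
  gcongr

/-- The linear involution exchanging the `j`-th coordinate with minus the sum of all coordinates. -/
def coordSumSwap {n : ℕ} (j : Fin n) : (Fin n → ℝ) ≃ₗ[ℝ] (Fin n → ℝ) :=
  LinearEquiv.ofInvolutive
    { toFun := fun v => Function.update v j (-∑ i, v i)
      map_add' := fun v w => by
        ext i
        rcases eq_or_ne i j with rfl | hi
        · simp [Finset.sum_add_distrib, add_comm]
        · simp [hi]
      map_smul' := fun c v => by
        ext i
        rcases eq_or_ne i j with rfl | hi
        · simp [Finset.mul_sum]
        · simp [hi] }
    (fun v => by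
      ext i
      rcases eq_or_ne i j with rfl | hi
      · have := Finset.sum_eq_add_sum_sdiff_singleton_of_mem (Finset.mem_univ i) v
        simp only [LinearMap.coe_mk, AddHom.coe_mk, Function.update_self,
          Finset.sum_update_of_mem (Finset.mem_univ i)]
        linarith
      · simp [hi])

lemma coordSumSwap_apply {n : ℕ} (j : Fin n) (v : Fin n → ℝ) :
    coordSumSwap j v = Function.update v j (-∑ i, v i) := rfl

lemma integrable_comp_linearEquiv {n : ℕ} {f : (Fin n → ℝ) → ℝ} (hf : Integrable f)
    (e : (Fin n → ℝ) ≃ₗ[ℝ] (Fin n → ℝ)) : Integrable fun v => f (e v) := by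
  have hdet : LinearMap.det (e : (Fin n → ℝ) →ₗ[ℝ] (Fin n → ℝ)) ≠ 0 := e.isUnit_det'.ne_zero
  have hm := Measure.map_linearMap_addHaar_eq_smul_addHaar
    (volume : Measure (Fin n → ℝ)) hdet
  refine Integrable.comp_measurable (f := e) (g := f) ?_
    (LinearMap.continuous_of_finiteDimensional
      (e : (Fin n → ℝ) →ₗ[ℝ] (Fin n → ℝ))).measurable
  have hm' : Measure.map e (volume : Measure (Fin n → ℝ)) = _ := hm
  rw [hm']
  exact hf.smul_measure ENNReal.ofReal_ne_top

lemma integrable_fejerMajorant {n : ℕ} (hn : 1 ≤ n) : Integrable (fejerMajorant n) := by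
  have hn0 : (0 : ℝ) < n := by exact_mod_cast hn
  set R : (Fin n → ℝ) → ℝ := fun v => ∏ i, ((1 + |v i|)⁻¹) ^ (1 + (n : ℝ)⁻¹) with hR
  have hR0 : ∀ v, 0 ≤ R v := fun v => Finset.prod_nonneg fun i _ => by positivity
  have hRint : Integrable R := by
    refine Integrable.fintype_prod (f := fun (_ : Fin n) (x : ℝ) =>
      ((1 + |x|)⁻¹) ^ (1 + (n : ℝ)⁻¹)) fun _ => ?_
    have hr : (Module.finrank ℝ ℝ : ℝ) < 1 + (n : ℝ)⁻¹ := by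
      rw [Module.finrank_self]
      push_cast
      linarith [inv_pos.2 hn0]
    refine (integrable_one_add_norm (μ := (volume : Measure ℝ)) hr).congr
      (Eventually.of_forall fun x => ?_)
    simp only [Real.norm_eq_abs]
    rw [Real.rpow_neg (by positivity), Real.inv_rpow (by positivity)]
  have hsum : Integrable fun v => R v + ∑ j : Fin n, R (coordSumSwap j v) :=
    hRint.add (integrable_finsetSum _ fun j _ => integrable_comp_linearEquiv hRint _)
  refine hsum.mono' (continuous_fejerMajorant n).aestronglyMeasurable
    (Eventually.of_forall fun v => ?_)
  rw [Real.norm_eq_abs, abs_of_nonneg (fejerMajorant_nonneg n v)]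
  have hsum0 : 0 ≤ ∑ j : Fin n, R (coordSumSwap j v) := Finset.sum_nonneg fun j _ => hR0 _
  have : Nonempty (Fin n) := ⟨⟨0, hn⟩⟩
  obtain ⟨j, -, hj⟩ := Finset.exists_min_image Finset.univ (fun i => (1 + |v i|)⁻¹)
    Finset.univ_nonempty
  rcases le_total ((1 + |∑ i, v i|)⁻¹) ((1 + |v j|)⁻¹) with hc | hc
  · have := mul_prod_le_prod_rpow hn (fun i => (1 + |v i|)⁻¹) (fun i => by positivity)
      (x := (1 + |∑ i, v i|)⁻¹) (by positivity) fun i => hc.trans (hj i (Finset.mem_univ _))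
    have h2 : fejerMajorant n v ≤ R v := this
    linarith
  · set w := coordSumSwap j v with hw
    have hwj : |w j| = |∑ i, v i| := by
      rw [hw, coordSumSwap_apply, Function.update_self, abs_neg]
    have hwi : ∀ i, i ≠ j → w i = v i := fun i hi => by
      rw [hw, coordSumSwap_apply, Function.update_of_ne hi]
    have := mul_prod_le_prod_rpow hn (fun i => (1 + |w i|)⁻¹) (fun i => by positivity)
      (x := (1 + |v j|)⁻¹) (by positivity) fun i => by
        rcases eq_or_ne i j with rfl | hi
        · simpa only [hwj] using hc
        · simpa only [hwi i hi] using hj i (Finset.mem_univ _)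
    have heq : fejerMajorant n v = (∏ i, (1 + |w i|)⁻¹) * (1 + |v j|)⁻¹ := by
      unfold fejerMajorant
      rw [← Finset.mul_prod_erase _ _ (Finset.mem_univ j),
        ← Finset.mul_prod_erase _ (fun i => (1 + |w i|)⁻¹) (Finset.mem_univ j), hwj,
        Finset.prod_congr rfl fun i hi =>
          show (1 + |v i|)⁻¹ = (1 + |w i|)⁻¹ by rw [hwi i (Finset.ne_of_mem_erase hi)]]
      ring
    have h2 : fejerMajorant n v ≤ R w := heq.trans_le this
    have h3 : R w ≤ ∑ j : Fin n, R (coordSumSwap j v) :=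
      Finset.single_le_sum (f := fun j => R (coordSumSwap j v)) (fun j _ => hR0 _)
        (Finset.mem_univ j)
    linarith [hR0 v]

lemma measurableSet_cube (n : ℕ) (δ : ℝ) : MeasurableSet {u : Fin n → ℝ | ∀ i, |u i| ≤ δ} := by
  rw [Set.ofPred_forall]
  exact MeasurableSet.iInter fun i => (isClosed_le (continuous_apply i).abs
    continuous_const).measurableSet

open scoped Pointwise in
lemma smul_compl_cube {n : ℕ} {T : ℝ} (hT : 0 < T) (δ : ℝ) :
    T • ({u : Fin n → ℝ | ∀ i, |u i| ≤ δ})ᶜ = ({v : Fin n → ℝ | ∀ i, |v i| ≤ T * δ})ᶜ := by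
  ext v
  rw [Set.mem_smul_set_iff_inv_smul_mem₀ hT.ne']
  simp only [Set.mem_compl_iff, Set.mem_ofPred_eq, Pi.smul_apply, smul_eq_mul, abs_mul, abs_inv,
    abs_of_pos hT, inv_mul_le_iff₀ hT]

lemma tendsto_setIntegral_compl_cube {n : ℕ} {f : (Fin n → ℝ) → ℝ} (hf : Integrable f)
    {δ : ℝ} (hδ : 0 < δ) :
    Tendsto (fun T : ℝ => ∫ v in ({v : Fin n → ℝ | ∀ i, |v i| ≤ T * δ})ᶜ, f v) atTop (𝓝 0) := by
  have hmeas := fun T : ℝ => (measurableSet_cube n (T * δ)).compl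
  simp only [← integral_indicator (hmeas _)]
  rw [← integral_zero (Fin n → ℝ) ℝ]
  refine tendsto_integral_filter_of_dominated_convergence (fun v => ‖f v‖)
    (Eventually.of_forall fun T => hf.aestronglyMeasurable.indicator (hmeas T))
    (Eventually.of_forall fun T => Eventually.of_forall fun v => norm_indicator_le_norm_self _ _)
    hf.norm (Eventually.of_forall fun v => ?_)
  refine tendsto_const_nhds.congr' ?_
  filter_upwards [eventually_ge_atTop (‖v‖ / δ)] with T hT
  rw [Set.indicator_of_notMem]
  rw [Set.notMem_compl_iff]
  exact fun i => (norm_le_pi_norm v i).trans ((div_le_iff₀ hδ).1 hT)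

lemma exists_abs_fejerKer_le {h : ℝ → ℝ} (hh : IsTaper h) (k : ℕ) :
    ∃ K : ℝ, ∀ T : ℝ, 0 < T → ∀ u : Fin (k - 1) → ℝ,
      |fejerKer h k T u| ≤ K * (T ^ (k - 1) * fejerMajorant (k - 1) (T • u)) := by
  obtain ⟨C, hC0, hC⟩ := hh.exists_norm_fourier_le
  refine ⟨C ^ (k - 1) * C / |(2 * Real.pi) ^ (k - 1) * Hcoef h k|, fun T hT u => ?_⟩
  have hH : ∀ l : ℝ, ‖H1T h T l‖ ≤ T * (C * (1 + |T * l|)⁻¹) := by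
    intro l
    rw [H1T_eq_integral hh hT, norm_mul, Complex.norm_real, Real.norm_of_nonneg hT.le]
    exact mul_le_mul_of_nonneg_left (hC _) hT.le
  have hnum : ‖(∏ i, H1T h T (u i)) * H1T h T (-(∑ i, u i))‖ ≤
      C ^ (k - 1) * C * T * (T ^ (k - 1) * fejerMajorant (k - 1) (T • u)) := by
    rw [norm_mul, norm_prod]
    calc (∏ i, ‖H1T h T (u i)‖) * ‖H1T h T (-(∑ i, u i))‖
        ≤ (∏ i, T * (C * (1 + |T * u i|)⁻¹)) * (T * (C * (1 + |T * -(∑ i, u i)|)⁻¹)) := by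
          refine mul_le_mul (Finset.prod_le_prod (fun i _ => norm_nonneg _) fun i _ => hH _)
            (hH _) (norm_nonneg _) (Finset.prod_nonneg fun i _ => by positivity)
      _ = _ := by
          simp only [Finset.prod_mul_distrib, Finset.prod_const, Finset.card_univ,
            Fintype.card_fin, fejerMajorant, Pi.smul_apply, smul_eq_mul, ← Finset.mul_sum,
            mul_neg, abs_neg]
          ring
  refine (Complex.abs_re_le_norm _).trans ?_
  rw [norm_div, Complex.norm_real, Real.norm_eq_abs, mul_left_comm, abs_mul T, abs_of_pos hT]
  refine (div_le_div_of_nonneg_right hnum (by positivity)).trans_eq ?_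
  field_simp

/-- The mass of the Fejér-type tapered kernel outside any cube around the origin
vanishes as `T → ∞`. -/
theorem fejerKer_mass_outside_cube (h : ℝ → ℝ) (hh : IsTaper h) (k : ℕ) (hk : 2 ≤ k)
    (δ : ℝ) (hδ : 0 < δ) :
    Tendsto
      (fun T : ℝ =>
        ∫ u in ({u : Fin (k - 1) → ℝ | ∀ i, |u i| ≤ δ})ᶜ, |fejerKer h k T u|)
      atTop (𝓝 0) := by
  obtain ⟨K, hK⟩ := exists_abs_fejerKer_le hh k
  have hint := integrable_fejerMajorant (n := k - 1) (by omega)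
  have hlim := (tendsto_setIntegral_compl_cube hint hδ).const_mul K
  rw [mul_zero] at hlim
  refine squeeze_zero' (Eventually.of_forall fun T => integral_nonneg fun u => abs_nonneg _) ?_ hlim
  filter_upwards [eventually_gt_atTop 0] with T hT
  have hscale : Integrable fun u : Fin (k - 1) → ℝ =>
      K * (T ^ (k - 1) * fejerMajorant (k - 1) (T • u)) :=
    ((hint.comp_smul hT.ne').const_mul _).const_mul _
  calc ∫ u in ({u : Fin (k - 1) → ℝ | ∀ i, |u i| ≤ δ})ᶜ, |fejerKer h k T u|
      ≤ ∫ u in ({u : Fin (k - 1) → ℝ | ∀ i, |u i| ≤ δ})ᶜ,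
          K * (T ^ (k - 1) * fejerMajorant (k - 1) (T • u)) :=
        integral_mono_of_nonneg (Eventually.of_forall fun u => abs_nonneg _) hscale.integrableOn
          (Eventually.of_forall fun u => hK T hT u)
    _ = K * ∫ v in ({v : Fin (k - 1) → ℝ | ∀ i, |v i| ≤ T * δ})ᶜ, fejerMajorant (k - 1) v := by
        rw [integral_const_mul, integral_const_mul,
          Measure.setIntegral_comp_smul_of_pos _ _ _ hT, smul_compl_cube hT,
          Module.finrank_fin_fun, smul_eq_mul,
          mul_inv_cancel_left₀ (pow_pos hT _).ne']
end
end

section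
/- Let k ≥ 3 be an integer and h a taper. For every δ > 0 there is a constant M_δ > 0 such that for all T > 0 the Fejér-type tapered kernel satisfies ‖F^h_{k,T}‖_{L^{p_k}(ℝ^{k−1} \ E_δ)} ≤ M_δ, where E_δ := {u ∈ ℝ^{k−1} : |u_i| ≤ δ, i = 1,…,k−1}, p_k := (k−2)/(k−3) for k > 3, and p_3 := ∞. -/
open MeasureTheory Filter Topology
open scoped ENNReal NNReal

noncomputable section

/-- A compactly supported function of locally bounded variation is Lipschitz in `L¹` under small
translations. -/
lemma exists_integral_abs_sub_translate_le {h : ℝ → ℝ} (hc : Continuous h)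
    (hbv : LocallyBoundedVariationOn h Set.univ) (hs : Function.support h ⊆ Set.Icc 0 1) :
    ∃ B : ℝ, 0 ≤ B ∧ ∀ s : ℝ, |s| ≤ 1 → ∫ t, |h t - h (t + s)| ≤ B * |s| := by
  obtain ⟨p, q, hp, hq, hpq⟩ := hbv.exists_monotoneOn_sub_monotoneOn
  rw [monotoneOn_univ] at hp hq
  have hm : Monotone (fun t => p t + q t) := hp.add hq
  set m : ℝ → ℝ := fun t => p t + q t with hmdef
  have hmi : ∀ a b : ℝ, IntervalIntegrable m volume a b := fun a b => hm.intervalIntegrable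
  have hdiff : ∀ t s : ℝ, 0 ≤ s → |h t - h (t + s)| ≤ m (t + s) - m t := by
    intro t s hs0
    have h1 := hp (le_add_of_nonneg_right hs0 : t ≤ t + s)
    have h2 := hq (le_add_of_nonneg_right hs0 : t ≤ t + s)
    simp only [hpq, Pi.sub_apply, hmdef]
    rw [abs_le]
    constructor <;> linarith
  have key : ∀ s : ℝ, 0 ≤ s → s ≤ 1 →
      ∫ t, |h t - h (t + s)| ≤ (m 2 - m (-1)) * s := by
    intro s hs0 hs1
    have hsupp : ∀ t, t ∉ Set.Icc (-s) 1 → |h t - h (t + s)| = 0 := by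
      intro t ht
      have h1 : h t = 0 := by
        by_contra hne
        have := hs hne
        exact ht ⟨by linarith [this.1], this.2⟩
      have h2 : h (t + s) = 0 := by
        by_contra hne
        have := hs hne
        exact ht ⟨by linarith [this.1], by linarith [this.2]⟩
      simp [h1, h2]
    rw [← setIntegral_eq_integral_of_forall_compl_eq_zero hsupp, integral_Icc_eq_integral_Ioc,
      ← intervalIntegral.integral_of_le (by linarith)]
    have hmi' : ∀ a b : ℝ, IntervalIntegrable (fun t => m (t + s)) volume a b := fun a b =>
      Monotone.intervalIntegrable (fun x y hxy => hm (by linarith))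
    calc ∫ t in (-s)..1, |h t - h (t + s)|
        ≤ ∫ t in (-s)..1, (m (t + s) - m t) :=
          intervalIntegral.integral_mono_on (by linarith)
            (by apply Continuous.intervalIntegrable; fun_prop)
            ((hmi' _ _).sub (hmi _ _)) (fun t _ => hdiff t s hs0)
      _ = (∫ t in (1:ℝ)..(1 + s), m t) - ∫ t in (-s)..0, m t := by
          rw [intervalIntegral.integral_sub (hmi' _ _) (hmi _ _),
            intervalIntegral.integral_comp_add_right (fun t => m t),
            intervalIntegral.integral_interval_sub_interval_comm' (hmi _ _) (hmi _ _) (hmi _ _),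
            neg_add_cancel]
      _ ≤ (∫ _ in (1:ℝ)..(1 + s), m 2) - ∫ _ in (-s)..0, m (-1) := by
          apply sub_le_sub
          · exact intervalIntegral.integral_mono_on (by linarith) (hmi _ _) (by simp)
              (fun t ht => hm (by linarith [ht.2]))
          · exact intervalIntegral.integral_mono_on (by linarith) (by simp) (hmi _ _)
              (fun t ht => hm (by linarith [ht.1]))
      _ = (m 2 - m (-1)) * s := by
          simp only [intervalIntegral.integral_const, smul_eq_mul]; ring
  refine ⟨m 2 - m (-1), sub_nonneg.2 (hm (by norm_num)), fun s hs1 => ?_⟩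
  rcases le_total 0 s with h0 | h0
  · rw [abs_of_nonneg h0] at hs1 ⊢
    exact key s h0 hs1
  · rw [abs_of_nonpos h0] at hs1 ⊢
    refine le_trans (le_of_eq ?_) (key (-s) (by linarith) hs1)
    rw [← integral_add_right_eq_self _ (-s)]
    refine integral_congr_ae (Eventually.of_forall fun t => ?_)
    simp only [neg_add_cancel_right]
    rw [abs_sub_comm]

/-- The Fourier transform of a continuous function of bounded variation supported in `[0,1]`
decays like `1 / (1 + |y|)`. -/
lemma exists_norm_fourier_le_s5 {h : ℝ → ℝ} (hc : Continuous h)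
    (hbv : LocallyBoundedVariationOn h Set.univ) (hs : Function.support h ⊆ Set.Icc 0 1) :
    ∃ K : ℝ, 0 < K ∧ ∀ y : ℝ,
      ‖∫ t in (0:ℝ)..1, (h t : ℂ) * Complex.exp (-Complex.I * (y : ℂ) * (t : ℂ))‖
        ≤ K / (1 + |y|) := by
  obtain ⟨B, hB0, hB⟩ := exists_integral_abs_sub_translate_le hc hbv hs
  set A : ℝ := ∫ t in (0:ℝ)..1, |h t| with hA
  have hA0 : 0 ≤ A := intervalIntegral.integral_nonneg zero_le_one fun _ _ => abs_nonneg _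
  have htriv : ∀ y : ℝ,
      ‖∫ t in (0:ℝ)..1, (h t : ℂ) * Complex.exp (-Complex.I * (y : ℂ) * (t : ℂ))‖ ≤ A := by
    intro y
    refine (intervalIntegral.norm_integral_le_integral_norm zero_le_one).trans (le_of_eq ?_)
    refine intervalIntegral.integral_congr fun t _ => ?_
    have : -Complex.I * (y : ℂ) * (t : ℂ) = ((-(y * t) : ℝ) : ℂ) * Complex.I := by
      push_cast; ring
    simp only [norm_mul, this, Complex.norm_exp_ofReal_mul_I, mul_one, Complex.norm_real,
      Real.norm_eq_abs]
  have hcs : HasCompactSupport h :=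
    HasCompactSupport.of_support_subset_isCompact isCompact_Icc hs
  have hint : Integrable (fun t => (h t : ℂ)) :=
    (hc.integrable_of_hasCompactSupport hcs).ofReal
  have hdecay : ∀ y : ℝ, Real.pi ≤ |y| →
      ‖∫ t in (0:ℝ)..1, (h t : ℂ) * Complex.exp (-Complex.I * (y : ℂ) * (t : ℂ))‖ * |y|
        ≤ B * Real.pi := by
    intro y hy
    have hpi := Real.pi_pos
    have hy0 : 0 < |y| := hpi.trans_le hy
    have hyne : y ≠ 0 := abs_pos.1 hy0
    set w : ℝ := y / (2 * Real.pi) with hw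
    have hwne : w ≠ 0 := by positivity
    have hfour : ∫ t in (0:ℝ)..1, (h t : ℂ) * Complex.exp (-Complex.I * (y : ℂ) * (t : ℂ))
        = ∫ t : ℝ, Real.fourierChar (-inner ℝ t w) • (h t : ℂ) := by
      rw [intervalIntegral.integral_of_le zero_le_one, ← integral_Icc_eq_integral_Ioc,
        setIntegral_eq_integral_of_forall_compl_eq_zero]
      · refine integral_congr_ae (Eventually.of_forall fun t => ?_)
        simp only [Circle.smul_def, Real.fourierChar_apply, smul_eq_mul]
        rw [mul_comm]
        congr 2
        simp only [RCLike.inner_apply, conj_trivial, hw]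
        push_cast
        have : (Real.pi : ℂ) ≠ 0 := by exact_mod_cast hpi.ne'
        field_simp
      · intro t ht
        have : h t = 0 := by
          by_contra hne
          exact ht (hs hne)
        simp [this]
    set s : ℝ := (1 / (2 * ‖w‖ ^ 2)) • w with hsdef
    have hsabs : |s| = Real.pi / |y| := by
      rw [hsdef, smul_eq_mul, hw, Real.norm_eq_abs, sq_abs, abs_mul, abs_div, abs_div, abs_mul,
        abs_of_pos (show (0:ℝ) < 2 * Real.pi by positivity)]
      simp only [abs_one, abs_two, abs_pow, abs_div,
        abs_of_pos (show (0:ℝ) < 2 * Real.pi by positivity)]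
      field_simp
    have hs1 : |s| ≤ 1 := by rw [hsabs]; exact div_le_one_of_le₀ hy hy0.le
    have hle : ‖∫ t in (0:ℝ)..1, (h t : ℂ) * Complex.exp (-Complex.I * (y : ℂ) * (t : ℂ))‖
        ≤ ∫ t, |h t - h (t + s)| := by
      rw [hfour, fourierIntegral_eq_half_sub_half_period_translate hwne hint, norm_smul]
      have h1 : ‖∫ t : ℝ, Real.fourierChar (-inner ℝ t w) • ((h t : ℂ) - (h (t + s) : ℂ))‖
          ≤ ∫ t, |h t - h (t + s)| := by
        refine (norm_integral_le_integral_norm _).trans (le_of_eq ?_)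
        refine integral_congr_ae (Eventually.of_forall fun t => ?_)
        simp only [Circle.norm_smul]
        rw [← Complex.ofReal_sub, Complex.norm_real, Real.norm_eq_abs]
      have h2 : ‖(1 / (2:ℂ))‖ ≤ 1 := by norm_num
      exact (mul_le_of_le_one_left (norm_nonneg _) h2).trans h1
    calc _ ≤ (B * |s|) * |y| := by gcongr; exact hle.trans (hB s hs1)
      _ = B * Real.pi := by rw [hsabs]; field_simp
  refine ⟨A * (1 + Real.pi) + B * Real.pi + 1, by positivity, fun y => ?_⟩
  rw [le_div_iff₀ (by positivity)]
  have h1 := htriv y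
  have hpi := Real.pi_pos
  rcases le_total Real.pi |y| with hy | hy
  · have h2 := hdecay y hy
    have : 0 ≤ A * Real.pi := by positivity
    nlinarith
  · have : 0 ≤ B * Real.pi := by positivity
    have h3 := mul_le_mul h1 (add_le_add_right hy 1) (by positivity) hA0
    linarith

lemma exists_norm_H1T_le {h : ℝ → ℝ} (hh : IsTaper h) :
    ∃ K : ℝ, 0 < K ∧ ∀ T : ℝ, 0 < T → ∀ x : ℝ, ‖H1T h T x‖ ≤ K * (T / (1 + T * |x|)) := by
  obtain ⟨hc, -, hbv, hs, -⟩ := hh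
  obtain ⟨K, hK, hKb⟩ := exists_norm_fourier_le_s5 hc hbv.locallyBoundedVariationOn hs
  refine ⟨K, hK, fun T hT x => ?_⟩
  have hscale : H1T h T x = (T : ℂ) *
      ∫ t in (0:ℝ)..1, (h t : ℂ) * Complex.exp (-Complex.I * ((T * x : ℝ) : ℂ) * (t : ℂ)) := by
    have := intervalIntegral.integral_comp_div (a := 0) (b := T)
      (fun t : ℝ => (h t : ℂ) * Complex.exp (-Complex.I * ((T * x : ℝ) : ℂ) * (t : ℂ))) hT.ne'
    rw [zero_div, div_self hT.ne', Complex.real_smul] at this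
    rw [← this, H1T]
    refine intervalIntegral.integral_congr fun t _ => ?_
    have hT' : (T : ℂ) ≠ 0 := by exact_mod_cast hT.ne'
    congr 2
    push_cast
    field_simp
  rw [hscale, norm_mul, Complex.norm_real, Real.norm_eq_abs, abs_of_pos hT]
  have := hKb (T * x)
  rw [abs_mul, abs_of_pos hT] at this
  calc _ ≤ T * (K / (1 + T * |x|)) := by gcongr
    _ = _ := by ring

/-- The even profile `T / (1 + T |x|)`, comparable to `min T |x|⁻¹`. -/
def peak (T x : ℝ) : ℝ := T / (1 + T * |x|)

lemma peak_nonneg {T : ℝ} (hT : 0 ≤ T) (x : ℝ) : 0 ≤ peak T x := by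
  unfold peak; positivity

lemma peak_neg (T x : ℝ) : peak T (-x) = peak T x := by simp [peak]

lemma peak_le {T : ℝ} (hT : 0 < T) (x : ℝ) : peak T x ≤ T :=
  div_le_self hT.le (le_add_of_nonneg_right (by positivity))

lemma continuous_peak {T : ℝ} (hT : 0 < T) : Continuous (peak T) := by
  unfold peak
  exact continuous_const.div (by fun_prop) fun x => by positivity

lemma peak_le_of_le_abs {T c x : ℝ} (hT : 0 < T) (hc : 0 < c) (hx : c ≤ |x|) :
    peak T x ≤ (1 + 1 / c) * peak 1 x := by
  have hx0 : 0 < |x| := hc.trans_le hx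
  have h1 : peak T x ≤ 1 / |x| := by
    unfold peak
    rw [div_le_div_iff₀ (by positivity) hx0]
    linarith
  refine h1.trans ?_
  have h2 : 1 ≤ |x| / c := (one_le_div hc).2 hx
  unfold peak
  rw [mul_one_div, one_mul, div_le_div_iff₀ hx0 (by positivity)]
  have : (1 + 1 / c) * |x| = |x| + |x| / c := by ring
  linarith

lemma integral_peak_rpow {T p : ℝ} (hT : 0 < T) :
    ∫ x, peak T x ^ p = T ^ (p - 1) * ∫ x : ℝ, (1 + |x|) ^ (-p) := by
  have h1 : ∀ x, peak T x ^ p = T ^ p * (fun y : ℝ => (1 + |y|) ^ (-p)) (T * x) := by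
    intro x
    simp only [peak, abs_mul, abs_of_pos hT]
    rw [Real.div_rpow hT.le (by positivity), Real.rpow_neg (by positivity), div_eq_mul_inv]
  rw [funext h1, integral_const_mul,
    Measure.integral_comp_mul_left (fun y : ℝ => (1 + |y|) ^ (-p)), abs_of_pos (inv_pos.2 hT),
    smul_eq_mul, ← mul_assoc, Real.rpow_sub_one hT.ne', div_eq_mul_inv]

lemma integrable_peak_rpow {T p : ℝ} (hT : 0 < T) (hp : 1 < p) :
    Integrable (fun x => peak T x ^ p) := by
  have h0 : Integrable (fun x : ℝ => (1 + ‖x‖) ^ (-p)) :=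
    integrable_one_add_norm (by simpa using hp)
  refine ((h0.comp_mul_left' hT.ne').const_mul (T ^ p)).congr (Eventually.of_forall fun x => ?_)
  simp only [peak, norm_mul, Real.norm_eq_abs, abs_of_pos hT]
  rw [Real.div_rpow hT.le (by positivity), Real.rpow_neg (by positivity), div_eq_mul_inv]

section Product

variable {ι : Type*} [Fintype ι] [DecidableEq ι]

/-- The product of the profiles `peak T` in all coordinates but `i`, where the profile is
`peak 1`. -/
def peakProd (T : ℝ) (i : ι) (u : ι → ℝ) : ℝ := ∏ l, peak (if l = i then 1 else T) (u l)

lemma peakProd_nonneg {T : ℝ} (hT : 0 ≤ T) (i : ι) (u : ι → ℝ) : 0 ≤ peakProd T i u :=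
  Finset.prod_nonneg fun l _ => peak_nonneg (by split_ifs <;> positivity) _

lemma peakProd_eq (T : ℝ) (i : ι) (u : ι → ℝ) :
    peakProd T i u = peak 1 (u i) * ∏ l ∈ Finset.univ.erase i, peak T (u l) := by
  rw [peakProd, ← Finset.mul_prod_erase _ _ (Finset.mem_univ i), if_pos rfl]
  congr 1
  exact Finset.prod_congr rfl fun l hl => by rw [if_neg (Finset.ne_of_mem_erase hl)]

lemma continuous_peakProd {T : ℝ} (hT : 0 < T) (i : ι) : Continuous (peakProd T i) :=
  continuous_finsetProd _ fun l _ =>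
    (continuous_peak (by split_ifs <;> positivity)).comp (continuous_apply l)

lemma peakProd_le {T : ℝ} (hT : 0 < T) (i : ι) (u : ι → ℝ) :
    peakProd T i u ≤ T ^ (Fintype.card ι - 1) := by
  rw [peakProd_eq]
  calc peak 1 (u i) * ∏ l ∈ Finset.univ.erase i, peak T (u l)
      ≤ 1 * ∏ _l ∈ Finset.univ.erase i, T := by
        apply mul_le_mul (peak_le one_pos _) _ _ zero_le_one
        · exact Finset.prod_le_prod (fun l _ => peak_nonneg hT.le _) fun l _ => peak_le hT _
        · exact Finset.prod_nonneg fun l _ => peak_nonneg hT.le _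
    _ = T ^ (Fintype.card ι - 1) := by
        rw [one_mul, Finset.prod_const, Finset.card_erase_of_mem (Finset.mem_univ i),
          Finset.card_univ]

lemma integral_peakProd_rpow {T p : ℝ} (hT : 0 < T) (i : ι) :
    ∫ u, peakProd T i u ^ p =
      (T ^ (p - 1)) ^ (Fintype.card ι - 1) * (∫ x : ℝ, (1 + |x|) ^ (-p)) ^ Fintype.card ι := by
  have h1 : ∀ u : ι → ℝ, peakProd T i u ^ p = ∏ l, peak (if l = i then 1 else T) (u l) ^ p :=
    fun u => (Real.finsetProd_rpow _ _
      (fun l _ => peak_nonneg (by split_ifs <;> positivity) _) _).symm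
  simp_rw [h1]
  rw [integral_fintype_prod_volume_eq_prod (fun l x => peak (if l = i then 1 else T) x ^ p)]
  have h2 : ∀ l, ∫ x, peak (if l = i then 1 else T) x ^ p =
      (if l = i then 1 else T) ^ (p - 1) * ∫ x : ℝ, (1 + |x|) ^ (-p) :=
    fun l => integral_peak_rpow (by split_ifs <;> positivity)
  simp_rw [h2]
  rw [Finset.prod_mul_distrib, Finset.prod_const, Finset.card_univ,
    ← Finset.mul_prod_erase _ _ (Finset.mem_univ i), if_pos rfl, Real.one_rpow, one_mul,
    Finset.prod_congr rfl (g := fun _ => T ^ (p - 1))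
      (fun l hl => by rw [if_neg (Finset.ne_of_mem_erase hl)]), Finset.prod_const,
    Finset.card_erase_of_mem (Finset.mem_univ i), Finset.card_univ]

lemma integrable_peakProd_rpow {T p : ℝ} (hT : 0 < T) (hp : 1 < p) (i : ι) :
    Integrable (fun u => peakProd T i u ^ p) := by
  have h1 : ∀ u : ι → ℝ, peakProd T i u ^ p = ∏ l, peak (if l = i then 1 else T) (u l) ^ p :=
    fun u => (Real.finsetProd_rpow _ _
      (fun l _ => peak_nonneg (by split_ifs <;> positivity) _) _).symm
  simp_rw [h1]
  exact Integrable.fintype_prod (f := fun l x => peak (if l = i then 1 else T) x ^ p)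
    fun l => integrable_peak_rpow (by split_ifs <;> positivity) hp

lemma eLpNorm_peakProd_le {T p : ℝ} (hT : 0 < T) (hp : 1 < p) (i : ι)
    (hcard : (p - 1) * ((Fintype.card ι - 1 : ℕ) : ℝ) = p) :
    eLpNorm (peakProd T i) (ENNReal.ofReal p) volume ≤
      ENNReal.ofReal (((∫ x : ℝ, (1 + |x|) ^ (-p)) ^ Fintype.card ι) ^ (1 / p) * T) := by
  have hp0 : 0 < p := one_pos.trans hp
  have hJ : 0 ≤ ∫ x : ℝ, (1 + |x|) ^ (-p) := integral_nonneg fun x => by positivity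
  rw [eLpNorm_eq_lintegral_rpow_enorm_toReal (by simpa using hp0) ENNReal.ofReal_ne_top,
    ENNReal.toReal_ofReal hp0.le]
  have h1 : ∀ u : ι → ℝ, ‖peakProd T i u‖ₑ ^ p = ENNReal.ofReal (peakProd T i u ^ p) := by
    intro u
    rw [Real.enorm_of_nonneg (peakProd_nonneg hT.le i u),
      ENNReal.ofReal_rpow_of_nonneg (peakProd_nonneg hT.le i u) hp0.le]
  simp_rw [h1]
  rw [← ofReal_integral_eq_lintegral_ofReal (integrable_peakProd_rpow hT hp i)
    (Eventually.of_forall fun u => Real.rpow_nonneg (peakProd_nonneg hT.le i u) _),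
    integral_peakProd_rpow hT, ENNReal.ofReal_rpow_of_nonneg (by positivity) (by positivity),
    ← Real.rpow_mul_natCast hT.le, hcard, Real.mul_rpow (by positivity) (by positivity),
    ← Real.rpow_mul hT.le, mul_one_div_cancel hp0.ne', Real.rpow_one, mul_comm]

/-- The linear involution `u_j ↦ -(∑ l, u l)` of `ι → ℝ`, for `j : Option ι`; the identity for
`none`. -/
def reflectSum : Option ι → (ι → ℝ) →ₗ[ℝ] (ι → ℝ)
  | none => LinearMap.id
  | some j => LinearMap.id -
      (LinearMap.single ℝ (fun _ => ℝ) j).comp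
        (LinearMap.proj j + ∑ l, LinearMap.proj (R := ℝ) (φ := fun _ : ι => ℝ) l)

lemma reflectSum_some_self (j : ι) (u : ι → ℝ) : reflectSum (some j) u j = -∑ l, u l := by
  simp [reflectSum]

lemma reflectSum_some_of_ne {j l : ι} (hl : l ≠ j) (u : ι → ℝ) :
    reflectSum (some j) u l = u l := by
  simp [reflectSum, hl]

lemma sum_reflectSum_some (j : ι) (u : ι → ℝ) : ∑ l, reflectSum (some j) u l = -u j := by
  rw [← Finset.add_sum_erase _ _ (Finset.mem_univ j), reflectSum_some_self,
    Finset.sum_congr rfl (g := u)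
      (fun l hl => reflectSum_some_of_ne (Finset.ne_of_mem_erase hl) u),
    ← Finset.add_sum_erase _ u (Finset.mem_univ j)]
  ring

lemma reflectSum_comp_self (o : Option ι) :
    (reflectSum o).comp (reflectSum o) = LinearMap.id := by
  cases o with
  | none => rfl
  | some j =>
    refine LinearMap.ext fun u => funext fun l => ?_
    rw [LinearMap.comp_apply, LinearMap.id_apply]
    by_cases hl : l = j
    · subst hl
      rw [reflectSum_some_self, sum_reflectSum_some, neg_neg]
    · rw [reflectSum_some_of_ne hl, reflectSum_some_of_ne hl]

lemma measurePreserving_reflectSum (o : Option ι) :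
    MeasurePreserving (reflectSum o : (ι → ℝ) → ι → ℝ) volume volume := by
  have hdet : |LinearMap.det (reflectSum o : (ι → ℝ) →ₗ[ℝ] _)| = 1 := by
    have h := congrArg LinearMap.det (reflectSum_comp_self o)
    rw [LinearMap.det_comp, LinearMap.det_id] at h
    have h2 := congrArg abs h
    rw [abs_mul, abs_one] at h2
    nlinarith [abs_nonneg (LinearMap.det (reflectSum o : (ι → ℝ) →ₗ[ℝ] _))]
  refine ⟨(LinearMap.continuous_of_finiteDimensional _).measurable, ?_⟩
  rw [Real.map_linearMap_volume_pi_eq_smul_volume_pi (by rw [← abs_pos, hdet]; exact one_pos),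
    abs_inv, hdet]
  simp

/-- If some coordinate is large, then so is a second one among the coordinates and their sum. -/
lemma abs_sum_ge_or_exists_abs_ge {δ : ℝ} {u : ι → ℝ} {i : ι} (hi : δ < |u i|) :
    δ / Fintype.card ι ≤ |∑ l, u l| ∨ ∃ j, j ≠ i ∧ δ / Fintype.card ι ≤ |u j| := by
  by_contra! hcon
  obtain ⟨h1, h2⟩ := hcon
  set c := δ / Fintype.card ι
  have hcard : (0 : ℝ) < Fintype.card ι := by exact_mod_cast Fintype.card_pos_iff.2 ⟨i⟩
  have h3 : u i = ∑ l, u l - ∑ l ∈ Finset.univ.erase i, u l := by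
    rw [← Finset.add_sum_erase _ u (Finset.mem_univ i)]; ring
  have h4 : |∑ l ∈ Finset.univ.erase i, u l| ≤ ∑ _l ∈ Finset.univ.erase i, c :=
    (Finset.abs_sum_le_sum_abs _ _).trans
      (Finset.sum_le_sum fun l hl => (h2 l (Finset.ne_of_mem_erase hl)).le)
  have h5 : ∑ _l ∈ Finset.univ.erase i, c = δ - c := by
    have h6 := Finset.add_sum_erase Finset.univ (fun _ : ι => c) (Finset.mem_univ i)
    have h7 : ∑ _l : ι, c = δ := by
      rw [Finset.sum_const, Finset.card_univ, nsmul_eq_mul, mul_div_cancel₀ _ hcard.ne']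
    linarith
  have h8 := abs_sub (∑ l, u l) (∑ l ∈ Finset.univ.erase i, u l)
  rw [← h3] at h8
  linarith

lemma prod_peak_mul_peak_sum_le {T δ : ℝ} (hT : 0 < T) (hδ : 0 < δ) {u : ι → ℝ} {i : ι}
    (hi : δ < |u i|) :
    (∏ l, peak T (u l)) * peak T (∑ l, u l) ≤
      (1 + 1 / (δ / Fintype.card ι)) ^ 2 *
        ∑ x : ι × Option ι, peakProd T x.1 (reflectSum x.2 u) := by
  have hcard : (1 : ℝ) ≤ Fintype.card ι := by exact_mod_cast Fintype.card_pos_iff.2 ⟨i⟩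
  have hc : 0 < δ / Fintype.card ι := by positivity
  have hci : δ / Fintype.card ι ≤ |u i| := (div_le_self hδ.le hcard).trans hi.le
  have hor := abs_sum_ge_or_exists_abs_ge hi
  set c := δ / Fintype.card ι
  set D := 1 + 1 / c
  have hD : 0 < D := by positivity
  have hpi : peak T (u i) ≤ D * peak 1 (u i) := peak_le_of_le_abs hT hc hci
  suffices hx : ∃ o, (∏ l, peak T (u l)) * peak T (∑ l, u l) ≤
      D ^ 2 * peakProd T i (reflectSum o u) by
    obtain ⟨o, ho⟩ := hx
    refine ho.trans (mul_le_mul_of_nonneg_left ?_ (by positivity))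
    exact Finset.single_le_sum (f := fun x : ι × Option ι => peakProd T x.1 (reflectSum x.2 u))
      (fun x _ => peakProd_nonneg hT.le _ _) (Finset.mem_univ (i, o))
  have hlarge : ∀ x, c ≤ |x| → peak T x ≤ D := fun x hx =>
    (peak_le_of_le_abs hT hc hx).trans (mul_le_of_le_one_right hD.le (peak_le one_pos _))
  rcases hor with hsum | ⟨j, hji, hj⟩
  · refine ⟨none, ?_⟩
    have hR : 0 ≤ ∏ l ∈ Finset.univ.erase i, peak T (u l) :=
      Finset.prod_nonneg fun l _ => peak_nonneg hT.le _
    rw [show reflectSum none u = u from rfl, peakProd_eq,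
      ← Finset.mul_prod_erase _ _ (Finset.mem_univ i)]
    calc peak T (u i) * (∏ l ∈ Finset.univ.erase i, peak T (u l)) * peak T (∑ l, u l)
        ≤ (D * peak 1 (u i)) * (∏ l ∈ Finset.univ.erase i, peak T (u l)) * D := by
          have := peak_nonneg zero_le_one (u i)
          have := peak_nonneg hT.le (∑ l, u l)
          gcongr
          exact hlarge _ hsum
      _ = _ := by ring
  · refine ⟨some j, ?_⟩
    have hjm : j ∈ Finset.univ.erase i := Finset.mem_erase.2 ⟨hji, Finset.mem_univ j⟩
    have hR : 0 ≤ ∏ l ∈ (Finset.univ.erase i).erase j, peak T (u l) :=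
      Finset.prod_nonneg fun l _ => peak_nonneg hT.le _
    have hrefl : ∏ l ∈ (Finset.univ.erase i).erase j, peak T (reflectSum (some j) u l) =
        ∏ l ∈ (Finset.univ.erase i).erase j, peak T (u l) :=
      Finset.prod_congr rfl fun l hl => by
        rw [reflectSum_some_of_ne (Finset.ne_of_mem_erase hl)]
    rw [peakProd_eq, ← Finset.mul_prod_erase _ _ (Finset.mem_univ i),
      ← Finset.mul_prod_erase _ _ hjm, ← Finset.mul_prod_erase _ _ hjm, reflectSum_some_self,
      reflectSum_some_of_ne hji.symm, peak_neg, hrefl]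
    calc peak T (u i) * (peak T (u j) * ∏ l ∈ (Finset.univ.erase i).erase j, peak T (u l)) *
            peak T (∑ l, u l)
        ≤ (D * peak 1 (u i)) * (D * ∏ l ∈ (Finset.univ.erase i).erase j, peak T (u l)) *
            peak T (∑ l, u l) := by
          have := peak_nonneg zero_le_one (u i)
          have := peak_nonneg hT.le (∑ l, u l)
          have := peak_nonneg hT.le (u j)
          gcongr
          exact hlarge _ hj
      _ = _ := by ring

end Product

lemma abs_fejerKer_le {h : ℝ → ℝ} {k : ℕ} {K T : ℝ} (hT : 0 < T) (hH : 0 < Hcoef h k)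
    (hK : ∀ x : ℝ, ‖H1T h T x‖ ≤ K * (T / (1 + T * |x|))) (u : Fin (k - 1) → ℝ) :
    |fejerKer h k T u| ≤ K ^ (k - 1) * K / ((2 * Real.pi) ^ (k - 1) * Hcoef h k) / T *
      ((∏ i, peak T (u i)) * peak T (∑ i, u i)) := by
  have hprod : ∏ i, ‖H1T h T (u i)‖ ≤ K ^ (k - 1) * ∏ i, peak T (u i) := by
    calc ∏ i, ‖H1T h T (u i)‖ ≤ ∏ i, (K * peak T (u i)) :=
          Finset.prod_le_prod (fun _ _ => norm_nonneg _) fun i _ => hK (u i)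
      _ = _ := by rw [Finset.prod_mul_distrib, Finset.prod_const, Finset.card_univ, Fintype.card_fin]
  have hsum : ‖H1T h T (-∑ i, u i)‖ ≤ K * peak T (∑ i, u i) := by
    rw [← peak_neg]; exact hK _
  have hden : 0 < (2 * Real.pi) ^ (k - 1) * (T * Hcoef h k) := by positivity
  refine (Complex.abs_re_le_norm _).trans ?_
  rw [norm_div, norm_mul, norm_prod, Complex.norm_real, Real.norm_of_nonneg hden.le]
  calc _ ≤ (K ^ (k - 1) * ∏ i, peak T (u i)) * (K * peak T (∑ i, u i)) /
        ((2 * Real.pi) ^ (k - 1) * (T * Hcoef h k)) := by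
        gcongr
        exact (Finset.prod_nonneg fun _ _ => norm_nonneg _).trans hprod
    _ = _ := by field_simp

lemma exists_eLpNorm_peakProd_le {k : ℕ} (hk : 3 ≤ k) :
    ∃ J : ℝ, 0 < J ∧ ∀ T : ℝ, 0 < T → ∀ i : Fin (k - 1),
      eLpNorm (peakProd T i)
        (if k = 3 then (⊤ : ℝ≥0∞) else ENNReal.ofReal (((k : ℝ) - 2) / ((k : ℝ) - 3))) volume
        ≤ ENNReal.ofReal (J * T) := by
  split_ifs with h3
  · subst h3
    refine ⟨1, one_pos, fun T hT i => ?_⟩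
    refine (eLpNorm_le_of_ae_bound (C := T) (Eventually.of_forall fun u => ?_)).trans ?_
    · rw [Real.norm_of_nonneg (peakProd_nonneg hT.le _ _)]
      simpa using peakProd_le hT i u
    · simp
  · have hk4 : (4 : ℝ) ≤ k := by exact_mod_cast (show 4 ≤ k by omega)
    set p : ℝ := ((k : ℝ) - 2) / ((k : ℝ) - 3) with hpdef
    have hp : 1 < p := by rw [hpdef, one_lt_div (by linarith)]; linarith
    set J := ((∫ x : ℝ, (1 + |x|) ^ (-p)) ^ Fintype.card (Fin (k - 1))) ^ (1 / p)
    have hJ : 0 ≤ J := by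
      have : 0 ≤ ∫ x : ℝ, (1 + |x|) ^ (-p) := integral_nonneg fun x => by positivity
      positivity
    refine ⟨J + 1, by positivity, fun T hT i => ?_⟩
    refine (eLpNorm_peakProd_le hT hp i ?_).trans (ENNReal.ofReal_le_ofReal ?_)
    · have : ((k - 1 - 1 : ℕ) : ℝ) = k - 2 := by
        rw [Nat.sub_sub, Nat.cast_sub (by omega)]; norm_num
      rw [Fintype.card_fin, this, hpdef]
      have : (k : ℝ) - 3 ≠ 0 := by linarith
      field_simp
      ring
    · exact mul_le_mul_of_nonneg_right (by linarith) hT.le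

/-- Uniform-in-`T` bound for the `L^{p_k}` norm of the Fejér-type tapered kernel
outside the cube `E_δ`, where `p_k = (k-2)/(k-3)` for `k > 3` and `p_3 = ∞`. -/
theorem fejerKer_Lp_bound_outside_cube (h : ℝ → ℝ) (hh : IsTaper h) (k : ℕ) (hk : 3 ≤ k)
    (δ : ℝ) (hδ : 0 < δ) :
    ∃ M : ℝ, 0 < M ∧ ∀ T : ℝ, 0 < T →
      eLpNorm (fun u => fejerKer h k T u)
        (if k = 3 then (⊤ : ℝ≥0∞) else ENNReal.ofReal (((k : ℝ) - 2) / ((k : ℝ) - 3)))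
        (volume.restrict ({u : Fin (k - 1) → ℝ | ∀ i, |u i| ≤ δ})ᶜ)
        ≤ ENNReal.ofReal M := by
  obtain ⟨K, hK, hKb⟩ := exists_norm_H1T_le hh
  obtain ⟨J, hJ, hJb⟩ := exists_eLpNorm_peakProd_le hk
  have hH : 0 < Hcoef h k := hh.2.2.2.2 k (by omega)
  set P : ℝ≥0∞ := if k = 3 then (⊤ : ℝ≥0∞) else ENNReal.ofReal (((k : ℝ) - 2) / ((k : ℝ) - 3))
    with hP
  have hP1 : 1 ≤ P := by
    rw [hP]
    split_ifs with h3
    · exact le_top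
    · have hk4 : (4 : ℝ) ≤ k := by exact_mod_cast (show 4 ≤ k by omega)
      rw [ENNReal.one_le_ofReal, one_le_div (by linarith)]
      linarith
  set C : ℝ := K ^ (k - 1) * K / ((2 * Real.pi) ^ (k - 1) * Hcoef h k)
  set D : ℝ := (1 + 1 / (δ / Fintype.card (Fin (k - 1)))) ^ 2
  set N : ℕ := Fintype.card (Fin (k - 1) × Option (Fin (k - 1)))
  have hC : 0 < C := by positivity
  have hD : 0 < D := by
    have : 0 < 1 + 1 / (δ / (Fintype.card (Fin (k - 1)) : ℝ)) := by positivity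
    positivity
  refine ⟨C * D * (N * J) + 1, by positivity, fun T hT => ?_⟩
  have hmeas : MeasurableSet ({u : Fin (k - 1) → ℝ | ∀ i, |u i| ≤ δ})ᶜ := by
    refine MeasurableSet.compl ?_
    simp only [Set.ofPred_forall]
    exact MeasurableSet.iInter fun i =>
      measurableSet_le (by fun_prop) measurable_const
  set G : (Fin (k - 1) → ℝ) → ℝ :=
    ∑ x : Fin (k - 1) × Option (Fin (k - 1)), peakProd T x.1 ∘ reflectSum x.2 with hG
  have hbound : ∀ u ∈ ({u : Fin (k - 1) → ℝ | ∀ i, |u i| ≤ δ})ᶜ,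
      ‖fejerKer h k T u‖ ≤ ((C / T * D) • G) u := by
    intro u hu
    simp only [Set.mem_compl_iff, Set.mem_ofPred_eq, not_forall, not_le] at hu
    obtain ⟨i, hi⟩ := hu
    refine (abs_fejerKer_le hT hH (hKb T hT) u).trans ?_
    rw [Pi.smul_apply, smul_eq_mul, mul_assoc, hG, Finset.sum_apply]
    exact mul_le_mul_of_nonneg_left (prod_peak_mul_peak_sum_le hT hδ hi) (by positivity)
  have hGnorm : eLpNorm G P volume ≤ ENNReal.ofReal (N * (J * T)) := by
    have hae : ∀ i : Fin (k - 1), AEStronglyMeasurable (peakProd T i) volume := fun i =>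
      (continuous_peakProd hT i).aestronglyMeasurable
    refine (eLpNorm_sum_le (fun x _ => (hae x.1).comp_measurePreserving
      (measurePreserving_reflectSum x.2)) hP1).trans ?_
    refine (Finset.sum_le_card_nsmul _ _ (ENNReal.ofReal (J * T)) fun x _ => ?_).trans ?_
    · rw [eLpNorm_comp_measurePreserving (hae x.1) (measurePreserving_reflectSum x.2)]
      exact hJb T hT x.1
    · rw [ENNReal.ofReal_mul (Nat.cast_nonneg N), ENNReal.ofReal_natCast, nsmul_eq_mul,
        Finset.card_univ]
  calc eLpNorm (fun u => fejerKer h k T u) P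
        (volume.restrict ({u : Fin (k - 1) → ℝ | ∀ i, |u i| ≤ δ})ᶜ)
      ≤ eLpNorm ((C / T * D) • G) P
        (volume.restrict ({u : Fin (k - 1) → ℝ | ∀ i, |u i| ≤ δ})ᶜ) :=
        eLpNorm_mono_ae_real (ae_restrict_of_forall_mem hmeas hbound)
    _ ≤ eLpNorm ((C / T * D) • G) P volume := eLpNorm_mono_measure _ Measure.restrict_le_self
    _ = ENNReal.ofReal (C / T * D) * eLpNorm G P volume := by
        rw [eLpNorm_const_smul, Real.enorm_of_nonneg (by positivity)]
    _ ≤ ENNReal.ofReal (C / T * D) * ENNReal.ofReal (N * (J * T)) := by gcongr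
    _ ≤ ENNReal.ofReal (C * D * (N * J) + 1) := by
        rw [← ENNReal.ofReal_mul (by positivity)]
        refine ENNReal.ofReal_le_ofReal (le_of_eq_of_le ?_ (le_add_of_nonneg_right zero_le_one))
        field_simp
end
end
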